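/- arXiv:1303.1163 — 9 statements merged into one kernel-verified Lean document; each statement's English description precedes it below -/
import Mathlib

section
/- Let F = {f_i}_{i=1}^k be a frame for ℝ^n. Then F is robust to one erasure if and only if there exist scalars c_i ≠ 0 for 1 ≤ i ≤ k such that Σ_{i=1}^k c_i f_i = 0. -/
open scoped InnerProductSpace

/-- A finite sequence of vectors in a finite-dimensional Hilbert space is a frame
iff it spans the space. -/
def IsFrame (𝕜 : Type*) [RCLike 𝕜] {H : Type*} [NormedAddCommGroup H]
    [InnerProductSpace 𝕜 H] {k : ℕ} (f : Fin k → H) : Prop :=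
  Submodule.span 𝕜 (Set.range f) = ⊤

/-- `F = {f i}` is robust to `r` erasures if deleting any `r` of the vectors
leaves a frame (i.e. a spanning family). -/
def RobustTo (𝕜 : Type*) [RCLike 𝕜] {H : Type*} [NormedAddCommGroup H]
    [InnerProductSpace 𝕜 H] {k : ℕ} (f : Fin k → H) (r : ℕ) : Prop :=
  ∀ I : Finset (Fin k), I.card = r →
    Submodule.span 𝕜 (f '' ((Iᶜ : Finset (Fin k)) : Set (Fin k))) = ⊤

/-- The maximum robustness of `F`: the largest number `r` (of possible erasures,
so `r ≤ k`) such that `F` is robust to `r` erasures. -/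
noncomputable def rob (𝕜 : Type*) [RCLike 𝕜] {H : Type*} [NormedAddCommGroup H]
    [InnerProductSpace 𝕜 H] {k : ℕ} (f : Fin k → H) : ℕ :=
  sSup {r : ℕ | r ≤ k ∧ RobustTo 𝕜 f r}

/-- Over an infinite field, a finite family in which each vector lies in the span of the others
satisfies a linear relation whose coefficients are all nonzero, and conversely. -/
theorem forall_mem_span_image_compl_iff_exists_sum_smul_eq_zero {K V ι : Type*} [Field K]
    [Infinite K] [AddCommGroup V] [Module K V] [Fintype ι] [DecidableEq ι] (f : ι → V) :
    (∀ i, f i ∈ Submodule.span K (f '' (({i}ᶜ : Finset ι) : Set ι))) ↔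
      ∃ c : ι → K, (∀ i, c i ≠ 0) ∧ ∑ i, c i • f i = 0 := by
  constructor
  · intro h
    obtain ⟨c, hc, hne⟩ := Module.Dual.exists_forall_mem_ne_zero_of_forall_exists
      (LinearMap.ker (Fintype.linearCombination K f))
      (fun i ↦ (LinearMap.proj i : (ι → K) →ₗ[K] K)) fun i ↦ by
        obtain ⟨a, ha⟩ := Submodule.mem_span_image_finset_iff_exists_fun' K |>.mp (h i)
        refine ⟨Function.update a i (-1), ?_, by simp⟩
        rw [LinearMap.mem_ker, Fintype.linearCombination_apply, Fintype.sum_eq_add_sum_compl i,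
          Function.update_self, neg_one_smul, neg_add_eq_zero, ← ha]
        refine Finset.sum_congr rfl fun j hj ↦ ?_
        rw [Function.update_of_ne (by simpa using hj)]
    exact ⟨c, hne, by simpa [Fintype.linearCombination_apply] using hc⟩
  · rintro ⟨c, hne, hc⟩ i
    rw [Fintype.sum_eq_add_sum_compl i, add_eq_zero_iff_eq_neg] at hc
    rw [← Submodule.smul_mem_iff _ (hne i), hc]
    exact neg_mem (sum_mem fun j hj ↦
      Submodule.smul_mem _ _ (Submodule.subset_span (Set.mem_image_of_mem f hj)))

/-- a frame for ℝ^n is robust to one erasure iff there are nonzero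
scalars `c i` with `∑ i, c i • f i = 0`. -/
theorem stmt1 {n k : ℕ} (f : Fin k → EuclideanSpace ℝ (Fin n)) (hf : IsFrame ℝ f) :
    RobustTo ℝ f 1 ↔
      ∃ c : Fin k → ℝ, (∀ i, c i ≠ 0) ∧ ∑ i, c i • f i = 0 := by
  classical
  rw [← forall_mem_span_image_compl_iff_exists_sum_smul_eq_zero]
  constructor
  · intro h i
    rw [h {i} (Finset.card_singleton i)]
    exact Submodule.mem_top
  · intro h I hI
    obtain ⟨i, rfl⟩ := Finset.card_eq_one.mp hI
    rw [eq_top_iff, ← show Submodule.span ℝ (Set.range f) = ⊤ from hf, Submodule.span_le]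
    rintro _ ⟨j, rfl⟩
    by_cases hj : j = i
    · subst hj
      simpa only [SetLike.mem_coe] using h j
    · exact Submodule.subset_span (Set.mem_image_of_mem f (by simpa using hj))
end

section
/- Let F = {f_i}_{i=1}^k be a frame for ℝ^n with synthesis operator θ*, the n×k matrix whose columns are f_1,...,f_k. Then F is robust to r erasures if and only if for every index set I ⊆ {1,...,k} with |I| = r − 1, the complement I^C belongs to {supp(f) : f ∈ null(θ*)}, where supp(f) ⊆ {1,...,k} is the set of indices at which the vector f ∈ ℝ^k has nonzero components. -/
open scoped InnerProductSpace

section Dependence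

variable {K V ι : Type*} [Field K] [AddCommGroup V] [Module K V] [Fintype ι] [DecidableEq ι]

/-- If every vector indexed by a finite set lies in the span of the others, then there is a linear
dependence with that set as its exact support. -/
theorem exists_sum_smul_eq_zero_support_eq [Infinite K] (f : ι → V) (s : Finset ι)
    (h : ∀ j ∈ s, f j ∈ Submodule.span K (f '' (s.erase j : Finset ι))) :
    ∃ x : ι → K, ∑ i, x i • f i = 0 ∧ {i | x i ≠ 0} = (s : Set ι) := by
  let p : Submodule K (ι → K) := LinearMap.ker (Fintype.linearCombination K f) ⊓
    ⨅ i ∈ sᶜ, LinearMap.ker (LinearMap.proj i)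
  have mem_p (x : ι → K) : x ∈ p ↔ ∑ i, x i • f i = 0 ∧ ∀ i ∉ s, x i = 0 := by
    simp [p, Fintype.linearCombination_apply]
  obtain ⟨x, hx, hx0⟩ := Module.Dual.exists_forall_mem_ne_zero_of_forall_exists p
      (fun j : s => (LinearMap.proj (j : ι) : (ι → K) →ₗ[K] K)) fun ⟨j, hj⟩ => by
    obtain ⟨c, hc⟩ := (Submodule.mem_span_image_finset_iff_exists_fun' K).mp (h j hj)
    refine ⟨fun i => if i = j then -1 else if i ∈ s then c i else 0, (mem_p _).mpr ⟨?_, ?_⟩, ?_⟩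
    · rw [← Finset.sum_subset s.subset_univ, ← Finset.add_sum_erase s _ hj,
        Finset.sum_congr rfl (g := fun i => c i • f i), hc]
      · simp
      · intro i hi
        simp [Finset.ne_of_mem_erase hi, Finset.mem_of_mem_erase hi]
      · intro i _ hi
        simp [hi, ne_of_mem_of_not_mem hj hi |>.symm]
    · intro i hi
      simp [hi, ne_of_mem_of_not_mem hj hi |>.symm]
    · simp
  obtain ⟨hsum, hzero⟩ := (mem_p x).mp hx
  refine ⟨x, hsum, Set.ext fun i => ⟨fun hi => ?_, fun hi => hx0 ⟨i, hi⟩⟩⟩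
  by_contra his
  exact hi (hzero i his)

/-- A spanning family still spans after deleting `J` if, for each `j ∈ J`, some linear dependence
has the complement of `J.erase j` as its exact support. -/
theorem span_image_compl_eq_top (f : ι → V) (hf : Submodule.span K (Set.range f) = ⊤)
    (J : Finset ι)
    (h : ∀ j ∈ J, ∃ x : ι → K, ∑ i, x i • f i = 0 ∧
      {i | x i ≠ 0} = (((J.erase j)ᶜ : Finset ι) : Set ι)) :
    Submodule.span K (f '' ((Jᶜ : Finset ι) : Set ι)) = ⊤ := by
  rw [eq_top_iff, ← hf, Submodule.span_le]
  rintro _ ⟨j, rfl⟩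
  by_cases hj : j ∈ J
  · obtain ⟨x, hsum, hsupp⟩ := h j hj
    have mem_supp (i : ι) : x i ≠ 0 ↔ i ∉ J.erase j := by
      simpa only [Finset.coe_compl, Set.mem_compl_iff, Finset.mem_coe, Set.mem_ofPred_eq] using
        Set.ext_iff.mp hsupp i
    have hxj : x j ≠ 0 := (mem_supp j).mpr (Finset.notMem_erase j J)
    rw [SetLike.mem_coe, ← Submodule.smul_mem_iff _ hxj,
      eq_neg_of_add_eq_zero_left ((Finset.add_sum_erase _ _ (Finset.mem_univ j)).trans hsum)]
    refine Submodule.neg_mem _ (Submodule.sum_mem _ fun i hi => ?_)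
    by_cases hxi : x i = 0
    · simp [hxi]
    · refine Submodule.smul_mem _ _ (Submodule.subset_span ⟨i, ?_, rfl⟩)
      have := (mem_supp i).mp hxi
      have := Finset.ne_of_mem_erase hi
      simp_all
  · exact Submodule.subset_span ⟨j, by simpa using hj, rfl⟩

end Dependence

/-- a frame for ℝ^n with synthesis matrix `A` (whose columns are the
frame vectors) is robust to `r` erasures iff for every index set `I` of size `r - 1`,
the complement of `I` is the support of some vector in the null space of `A`. -/
theorem stmt2 {n k r : ℕ} (hr : 1 ≤ r) (f : Fin k → EuclideanSpace ℝ (Fin n))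
    (hf : IsFrame ℝ f) (A : Matrix (Fin n) (Fin k) ℝ) (hA : ∀ i j, A i j = f j i) :
    RobustTo ℝ f r ↔
      ∀ I : Finset (Fin k), I.card = r - 1 →
        ∃ x : Fin k → ℝ, A.mulVec x = 0 ∧
          {i : Fin k | x i ≠ 0} = ((Iᶜ : Finset (Fin k)) : Set (Fin k)) := by
  have mulVec_eq_zero (x : Fin k → ℝ) : A.mulVec x = 0 ↔ ∑ i, x i • f i = 0 := by
    rw [funext_iff, PiLp.ext_iff]
    simp [Matrix.mulVec, dotProduct, hA, mul_comm]
  simp only [mulVec_eq_zero]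
  constructor
  · intro h I hI
    refine exists_sum_smul_eq_zero_support_eq f Iᶜ fun j hj => ?_
    rw [← Finset.compl_insert, h (insert j I)
      (by rw [Finset.card_insert_of_notMem (by simpa using hj)]; omega)]
    exact Submodule.mem_top
  · intro h J hJ
    exact span_image_compl_eq_top f hf J fun j hj =>
      h (J.erase j) (by rw [Finset.card_erase_of_mem hj, hJ])
end

section
/- Let F = {f_i}_{i=1}^k be a frame for H_n and let S = {I ⊆ {1,...,k} : span({f_i}_{i∈I}) = H_n} be the collection of index sets that correspond to spanning sets. Then rob(F) ≤ ⌊log₂|S|⌋. -/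
open scoped InnerProductSpace

/-- Robustness to `r ≤ k` erasures forces at least `2 ^ r` spanning index sets: the complements
of all subsets of a fixed `r`-element index set are spanning. -/
theorem RobustTo.two_pow_le_ncard {𝕜 : Type*} [RCLike 𝕜] {H : Type*} [NormedAddCommGroup H]
    [InnerProductSpace 𝕜 H] {k : ℕ} {f : Fin k → H} {r : ℕ} (h : RobustTo 𝕜 f r) (hr : r ≤ k) :
    2 ^ r ≤ Set.ncard {I : Finset (Fin k) |
      Submodule.span 𝕜 (f '' (I : Set (Fin k))) = ⊤} := by
  obtain ⟨I, -, hI⟩ := Finset.exists_subset_card_eq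
    (show r ≤ (Finset.univ : Finset (Fin k)).card by simpa using hr)
  rw [← hI, ← Finset.card_powerset, ← Set.ncard_coe_finset,
    ← Set.ncard_image_of_injective _ (compl_injective (α := Finset (Fin k)))]
  refine Set.ncard_le_ncard ?_ (Set.toFinite _)
  rintro _ ⟨J, hJ, rfl⟩
  have hJI : J ⊆ I := Finset.mem_powerset.mp hJ
  refine top_unique ((h I hI).ge.trans (Submodule.span_mono (Set.image_mono ?_)))
  exact Finset.coe_subset.mpr (Finset.compl_subset_compl.mpr hJI)

/-- if `S` is the collection of index sets of spanning subfamilies of a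
frame `F`, then `rob F ≤ ⌊log₂ |S|⌋`. -/
theorem stmt4 {𝕜 : Type*} [RCLike 𝕜] {H : Type*} [NormedAddCommGroup H]
    [InnerProductSpace 𝕜 H] {k : ℕ} (f : Fin k → H) (hf : IsFrame 𝕜 f) :
    rob 𝕜 f ≤
      Nat.log 2 (Set.ncard {I : Finset (Fin k) |
        Submodule.span 𝕜 (f '' (I : Set (Fin k))) = ⊤}) := by
  have hzero : RobustTo 𝕜 f 0 := by
    intro I hI
    obtain rfl := Finset.card_eq_zero.mp hI
    simpa [IsFrame] using hf
  refine csSup_le ⟨0, k.zero_le, hzero⟩ fun r ⟨hrk, hr⟩ => ?_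
  exact Nat.le_log_of_pow_le one_lt_two (hr.two_pow_le_ncard hrk)
end

section
/- If F = {f_i}_{i=1}^k is a frame for H_n, then there exists a vector y ∈ H_n such that rob(F) = |{i ∈ {1,...,k} : ⟨f_i, y⟩ ≠ 0}| − 1; that is, the maximum robustness of F equals one less than the number of indices i for which ⟨f_i, y⟩ is nonzero (equivalently, rob(F) equals the maximum robustness of the scalar sequence {⟨f_i, y⟩}_{i=1}^k regarded as a frame for the one-dimensional Hilbert space). -/
open scoped InnerProductSpace

theorem robustTo_of_lt_ncard {𝕜 : Type*} [RCLike 𝕜] {H : Type*} [NormedAddCommGroup H]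
    [InnerProductSpace 𝕜 H] [FiniteDimensional 𝕜 H] {k : ℕ} {f : Fin k → H} {r : ℕ}
    (h : ∀ y : H, y ≠ 0 → r < Set.ncard {i : Fin k | ⟪f i, y⟫_𝕜 ≠ 0}) : RobustTo 𝕜 f r := by
  intro I hI
  rw [← Submodule.orthogonal_eq_bot_iff, Submodule.eq_bot_iff]
  intro y hy
  by_contra hy0
  refine (h y hy0).not_ge ?_
  rw [← hI, ← Set.ncard_coe_finset]
  refine Set.ncard_le_ncard (fun i hi => ?_) I.finite_toSet
  by_contra hiI
  exact hi (hy (f i) (Submodule.subset_span ⟨i, by simpa using hiI, rfl⟩))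

theorem RobustTo.lt_ncard {𝕜 : Type*} [RCLike 𝕜] {H : Type*} [NormedAddCommGroup H]
    [InnerProductSpace 𝕜 H] {k : ℕ} {f : Fin k → H} {r : ℕ} (h : RobustTo 𝕜 f r) (hr : r ≤ k)
    {y : H} (hy : y ≠ 0) : r < Set.ncard {i : Fin k | ⟪f i, y⟫_𝕜 ≠ 0} := by
  classical
  by_contra! hle
  rw [Set.ncard_eq_toFinset_card'] at hle
  obtain ⟨I, hsub, hI⟩ := Finset.exists_superset_card_eq hle (by simpa using hr)
  have hspan : Submodule.span 𝕜 (f '' ((Iᶜ : Finset (Fin k)) : Set (Fin k))) ≤ (𝕜 ∙ y)ᗮ := by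
    rw [Submodule.span_le]
    rintro _ ⟨i, hi, rfl⟩
    rw [SetLike.mem_coe, Submodule.mem_orthogonal_singleton_iff_inner_left]
    by_contra hne
    have : i ∈ I := hsub (by simpa using hne)
    simp [this] at hi
  rw [h I hI, top_le_iff] at hspan
  have hmem : y ∈ (𝕜 ∙ y)ᗮ := hspan ▸ Submodule.mem_top
  rw [Submodule.mem_orthogonal_singleton_iff_inner_left, inner_self_eq_zero] at hmem
  exact hy hmem

/-- for any frame `F = {f i}` of a (nonzero, finite-dimensional) Hilbert
space there is a vector `y` such that `rob F` is one less than the number of indices `i`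
with `⟪f i, y⟫ ≠ 0`. -/
theorem stmt6 {𝕜 : Type*} [RCLike 𝕜] {H : Type*} [NormedAddCommGroup H]
    [InnerProductSpace 𝕜 H] [FiniteDimensional 𝕜 H] [Nontrivial H] {k : ℕ}
    (f : Fin k → H) (hf : IsFrame 𝕜 f) :
    ∃ y : H, rob 𝕜 f = Set.ncard {i : Fin k | ⟪f i, y⟫_𝕜 ≠ 0} - 1 := by
  let c : H → ℕ := fun y => Set.ncard {i : Fin k | ⟪f i, y⟫_𝕜 ≠ 0}
  obtain ⟨y, hy, hmin⟩ : ∃ y : H, y ≠ 0 ∧ ∀ z : H, z ≠ 0 → c y ≤ c z := by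
    have hne : {y : H | y ≠ 0}.Nonempty := exists_ne 0
    exact ⟨Function.argminOn c _ hne, Function.argminOn_mem c _ hne,
      fun z hz => Function.argminOn_le c _ hz⟩
  have hck : c y ≤ k := by
    simpa using Set.ncard_le_card {i : Fin k | ⟪f i, y⟫_𝕜 ≠ 0}
  have hpos : 0 < c y := by
    refine RobustTo.lt_ncard (fun I hI => ?_) k.zero_le hy
    rw [Finset.card_eq_zero.mp hI]
    simpa using show Submodule.span 𝕜 (Set.range f) = ⊤ from hf
  refine ⟨y, IsGreatest.csSup_eq ⟨⟨(Nat.sub_le _ _).trans hck, ?_⟩, ?_⟩⟩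
  · exact robustTo_of_lt_ncard fun z hz => (Nat.sub_one_lt hpos.ne').trans_le (hmin z hz)
  · rintro r ⟨hr, hrob⟩
    exact Nat.le_sub_one_of_lt (hrob.lt_ncard hr hy)
end

section
/- Let k ≥ n, λ > 0, and let F = {f_i}_{i=1}^k be a sequence of vectors in ℝ^n (or ℂ^n), not all of which are zero, with Gramian G. Then F is a λ-tight frame for ℝ^n (resp. ℂ^n) if and only if G has rank n and G² = λG. -/
open scoped InnerProductSpace

open scoped Matrix

/-- A Hermitian matrix whose quadratic form vanishes identically is zero. -/
theorem Matrix.IsHermitian.eq_zero_of_inner_toEuclideanLin_self {𝕜 ι : Type*} [RCLike 𝕜]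
    [Fintype ι] [DecidableEq ι] {M : Matrix ι ι 𝕜} (hM : M.IsHermitian)
    (h : ∀ v : EuclideanSpace 𝕜 ι, ⟪Matrix.toEuclideanLin M v, v⟫_𝕜 = 0) : M = 0 := by
  have hs := Matrix.isSymmetric_toEuclideanLin_iff.mpr hM
  exact (map_eq_zero_iff _ Matrix.toEuclideanLin.injective).mp (hs.inner_map_self_eq_zero.mp h)

/-- The frame sum of `f` is the quadratic form of `A * Aᴴ`, where `A` has the vectors `f i` as
columns. -/
theorem sum_norm_inner_sq_eq_inner_mul_conjTranspose {𝕜 ι κ : Type*} [RCLike 𝕜] [Fintype ι]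
    [DecidableEq ι] [Fintype κ] (f : κ → EuclideanSpace 𝕜 ι)
    (v : EuclideanSpace 𝕜 ι) :
    ((∑ i, ‖⟪v, f i⟫_𝕜‖ ^ 2 : ℝ) : 𝕜) =
      ⟪Matrix.toEuclideanLin (Matrix.of (fun r i => f i r) * (Matrix.of fun r i => f i r)ᴴ) v,
        v⟫_𝕜 := by
  classical
  have hw : Matrix.toEuclideanLin
      (Matrix.of (fun r i => f i r) * (Matrix.of fun r i => f i r)ᴴ) v =
      ∑ i, ⟪f i, v⟫_𝕜 • f i := by
    ext r
    simp [Matrix.toLpLin_apply, -Matrix.mulVec_mulVec, Matrix.mulVec, dotProduct,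
      PiLp.inner_apply, mul_comm]
  rw [hw, sum_inner]
  push_cast
  refine Finset.sum_congr rfl fun i _ => ?_
  rw [inner_smul_left, inner_conj_symm, ← RCLike.mul_conj, inner_conj_symm]

/-- Vectors form a `μ`-tight frame iff the matrix `A` having them as columns satisfies
`A * Aᴴ = μ • 1`. -/
theorem tight_frame_iff_mul_conjTranspose_eq {𝕜 ι κ : Type*} [RCLike 𝕜] [Fintype ι]
    [DecidableEq ι] [Fintype κ] (μ : ℝ) (f : κ → EuclideanSpace 𝕜 ι) :
    (∀ v : EuclideanSpace 𝕜 ι, ∑ i, ‖⟪v, f i⟫_𝕜‖ ^ 2 = μ * ‖v‖ ^ 2) ↔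
      Matrix.of (fun r i => f i r) * (Matrix.of fun r i => f i r)ᴴ =
        (μ : 𝕜) • (1 : Matrix ι ι 𝕜) := by
  have key (v : EuclideanSpace 𝕜 ι) :
      ⟪Matrix.toEuclideanLin ((μ : 𝕜) • (1 : Matrix ι ι 𝕜)) v, v⟫_𝕜 =
        ((μ * ‖v‖ ^ 2 : ℝ) : 𝕜) := by
    rw [map_smul, Matrix.toLpLin_one, LinearMap.smul_apply, LinearMap.id_apply,
      inner_smul_left, inner_self_eq_norm_sq_to_K]
    simp
  constructor
  · intro h
    rw [← sub_eq_zero]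
    refine Matrix.IsHermitian.eq_zero_of_inner_toEuclideanLin_self ?_ fun v => ?_
    · refine (Matrix.isHermitian_mul_conjTranspose_self _).sub ?_
      simp [Matrix.IsHermitian, Matrix.conjTranspose_smul]
    · rw [map_sub, LinearMap.sub_apply, inner_sub_left, key,
        ← sum_norm_inner_sq_eq_inner_mul_conjTranspose, h, sub_self]
  · intro h v
    have := sum_norm_inner_sq_eq_inner_mul_conjTranspose f v
    rw [h, key] at this
    exact RCLike.ofReal_injective this

open scoped ComplexOrder in
/-- For a scalar `c ≠ 0`, `A * Aᴴ = c • 1` iff `Aᴴ * A` has full rank and its square is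
`c` times itself. -/
theorem Matrix.mul_conjTranspose_eq_smul_one_iff {𝕜 ι κ : Type*} [RCLike 𝕜] [Fintype ι]
    [DecidableEq ι] [Fintype κ] {c : 𝕜} (hc : c ≠ 0) (A : Matrix ι κ 𝕜) :
    A * Aᴴ = c • (1 : Matrix ι ι 𝕜) ↔
      (Aᴴ * A).rank = Fintype.card ι ∧ (Aᴴ * A) * (Aᴴ * A) = c • (Aᴴ * A) := by
  have hrank : (Aᴴ * A).rank = (A * Aᴴ).rank := by
    rw [Matrix.rank_conjTranspose_mul_self, Matrix.rank_self_mul_conjTranspose]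
  constructor
  · intro h
    refine ⟨?_, ?_⟩
    · rw [hrank, h]
      refine Matrix.rank_of_isUnit _ ?_
      exact (isUnit_one.smul (Units.mk0 c hc) : IsUnit (Units.mk0 c hc • (1 : Matrix ι ι 𝕜)))
    · rw [Matrix.mul_assoc, ← Matrix.mul_assoc A, h]
      simp
  · rintro ⟨hr, h⟩
    rw [hrank] at hr
    have hu : IsUnit (A * Aᴴ) := by
      rw [← Matrix.mulVec_surjective_iff_isUnit]
      have : LinearMap.range (A * Aᴴ).mulVecLin = ⊤ :=
        Submodule.eq_top_of_finrank_eq (by simpa [Matrix.rank] using hr)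
      exact LinearMap.range_eq_top.mp this
    have h3 : (A * Aᴴ) * ((A * Aᴴ) * (A * Aᴴ)) = (c • (1 : Matrix ι ι 𝕜)) *
        ((A * Aᴴ) * (A * Aᴴ)) := by
      have := congrArg (fun M => A * M * Aᴴ) h
      simpa [Matrix.mul_assoc] using this
    exact (hu.mul hu).mul_right_cancel h3

/-- let `k ≥ n`, `μ > 0`, and `f : Fin k → 𝕜^n` (𝕜 = ℝ or ℂ) not all zero,
with Gramian `G` (entry `(i, j)` is the inner product of `f j` against `f i`).
Then `f` is a `μ`-tight frame iff `G` has rank `n` and `G² = μ G`. -/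
theorem stmt9 {𝕜 : Type*} [RCLike 𝕜] {n k : ℕ} (hkn : n ≤ k) {μ : ℝ} (hμ : 0 < μ)
    (f : Fin k → EuclideanSpace 𝕜 (Fin n)) (hnz : ∃ i, f i ≠ 0)
    (G : Matrix (Fin k) (Fin k) 𝕜) (hG : ∀ i j, G i j = ⟪f i, f j⟫_𝕜) :
    (∀ v : EuclideanSpace 𝕜 (Fin n), ∑ i, ‖⟪v, f i⟫_𝕜‖ ^ 2 = μ * ‖v‖ ^ 2) ↔
      (G.rank = n ∧ G * G = (μ : 𝕜) • G) := by
  have hGA : G = (Matrix.of fun r i => f i r)ᴴ * Matrix.of (fun r i => f i r) := by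
    ext i j
    simp [hG, Matrix.mul_apply, PiLp.inner_apply, mul_comm]
  rw [tight_frame_iff_mul_conjTranspose_eq, Matrix.mul_conjTranspose_eq_smul_one_iff
    (RCLike.ofReal_ne_zero.mpr hμ.ne'), Fintype.card_fin, ← hGA]
end

section
/- Let F = {f_i}_{i=1}^k be a tight frame for ℝ^n (or ℂ^n) consisting of nonzero vectors. If F has a tight subframe indexed by a nonempty proper subset I of {1,...,k} (i.e., {f_i}_{i∈I} is itself a tight frame for the whole space), then k ≥ 2n. -/
open scoped InnerProductSpace

/-- A tight frame for a finite-dimensional space has at least as many vectors as the dimension. -/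
theorem finrank_le_card_of_tight {𝕜 E ι : Type*} [RCLike 𝕜] [NormedAddCommGroup E]
    [InnerProductSpace 𝕜 E] (f : ι → E) (S : Finset ι) {c : ℝ} (hc : 0 < c)
    (h : ∀ v : E, ∑ i ∈ S, ‖⟪v, f i⟫_𝕜‖ ^ 2 = c * ‖v‖ ^ 2) :
    Module.finrank 𝕜 E ≤ S.card := by
  let T : E →ₗ[𝕜] (S → 𝕜) := LinearMap.pi fun i => (innerSL 𝕜 (f i)).toLinearMap
  have hT : Function.Injective T := by
    rw [← LinearMap.ker_eq_bot, LinearMap.ker_eq_bot']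
    intro v hv
    have hzero : ∑ i ∈ S, ‖⟪v, f i⟫_𝕜‖ ^ 2 = 0 := by
      refine Finset.sum_eq_zero fun i hi => ?_
      have hi' : ⟪f i, v⟫_𝕜 = 0 := congrFun hv ⟨i, hi⟩
      simp [inner_eq_zero_symm.mp hi']
    rw [h v] at hzero
    simpa [hc.ne'] using hzero
  simpa using LinearMap.finrank_le_finrank_of_injective hT

/-- if a tight frame `{f i}_{i=1}^k` of nonzero vectors for `𝕜^n`
(𝕜 = ℝ or ℂ) has a tight subframe indexed by a nonempty proper subset `I`, then
`k ≥ 2n`. -/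
theorem stmt12 {𝕜 : Type*} [RCLike 𝕜] {n k : ℕ}
    (f : Fin k → EuclideanSpace 𝕜 (Fin n)) (hnz : ∀ i, f i ≠ 0)
    (htight : ∃ μ : ℝ, 0 < μ ∧
      ∀ v : EuclideanSpace 𝕜 (Fin n), ∑ i, ‖⟪v, f i⟫_𝕜‖ ^ 2 = μ * ‖v‖ ^ 2)
    (I : Finset (Fin k)) (hne : I.Nonempty) (hproper : I ≠ Finset.univ)
    (hsub : ∃ ν : ℝ, 0 < ν ∧
      ∀ v : EuclideanSpace 𝕜 (Fin n), ∑ i ∈ I, ‖⟪v, f i⟫_𝕜‖ ^ 2 = ν * ‖v‖ ^ 2) :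
    2 * n ≤ k := by
  obtain ⟨μ, -, hμ⟩ := htight
  obtain ⟨ν, hν, hI⟩ := hsub
  have hIc : ∀ v : EuclideanSpace 𝕜 (Fin n),
      ∑ i ∈ Iᶜ, ‖⟪v, f i⟫_𝕜‖ ^ 2 = (μ - ν) * ‖v‖ ^ 2 := fun v => by
    have := Finset.sum_add_sum_compl I fun i => ‖⟪v, f i⟫_𝕜‖ ^ 2
    rw [hμ, hI] at this
    linarith
  obtain ⟨j, hj⟩ : ∃ j, j ∉ I := by
    by_contra! hall
    exact hproper (Finset.eq_univ_iff_forall.mpr hall)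
  have hpos : 0 < (μ - ν) * ‖f j‖ ^ 2 := by
    rw [← hIc]
    refine Finset.sum_pos' (fun _ _ => by positivity) ⟨j, Finset.mem_compl.mpr hj, ?_⟩
    have : ⟪f j, f j⟫_𝕜 ≠ 0 := inner_self_ne_zero.mpr (hnz j)
    positivity
  have hcard := finrank_le_card_of_tight f I hν hI
  have hcard_compl := finrank_le_card_of_tight f Iᶜ (pos_of_mul_pos_left hpos (by positivity)) hIc
  have htotal := I.card_add_card_compl
  simp only [finrank_euclideanSpace, Fintype.card_fin] at hcard hcard_compl htotal
  omega
end

section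
/- Let n ≥ 2 and let {f_i}_{i=1}^k be a tight frame for ℝ^n (or ℂ^n) consisting of nonzero vectors, with k ≥ n. Then for every r with 1 ≤ r ≤ n − 1: (i) no subsequence of {f_i}_{i=1}^k obtained by removing exactly r vectors is a tight frame for the whole space, and (ii) there is no sequence of r nonzero vectors {g_j}_{j=1}^r such that {f_i}_{i=1}^k ∪ {g_j}_{j=1}^r is a tight frame for the whole space. -/
open scoped InnerProductSpace

/-- A finite family with fewer members than the dimension can satisfy a Parseval-type identity
only if all its members vanish. -/
theorem eq_zero_of_sum_norm_inner_sq_eq {𝕜 E ι : Type*} [RCLike 𝕜] [NormedAddCommGroup E]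
    [InnerProductSpace 𝕜 E] [FiniteDimensional 𝕜 E] (s : Finset ι) (g : ι → E)
    (hs : s.card < Module.finrank 𝕜 E) (c : ℝ)
    (h : ∀ v : E, ∑ i ∈ s, ‖⟪v, g i⟫_𝕜‖ ^ 2 = c * ‖v‖ ^ 2) : ∀ i ∈ s, g i = 0 := by
  classical
  let K := Submodule.span 𝕜 (s.image g : Set E)
  have hK : K ≠ ⊤ := fun hK => by
    have hle : Module.finrank 𝕜 K ≤ (s.image g).card := finrank_span_finset_le_card _
    rw [hK, finrank_top] at hle
    exact absurd (hle.trans Finset.card_image_le) hs.not_ge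
  obtain ⟨v, hv, hv0⟩ := Submodule.exists_mem_ne_zero_of_ne_bot
    (mt K.orthogonal_eq_bot_iff.1 hK)
  have horth : ∀ i ∈ s, ⟪v, g i⟫_𝕜 = 0 := fun i hi =>
    K.inner_left_of_mem_orthogonal
      (Submodule.subset_span (Finset.mem_coe.2 (Finset.mem_image_of_mem g hi))) hv
  have hc : c = 0 := by
    have hsum := h v
    rw [Finset.sum_eq_zero fun i hi => by simp [horth i hi]] at hsum
    simpa [hv0] using hsum.symm
  intro i hi
  have hsum := h (g i)
  rw [hc, zero_mul, Finset.sum_eq_zero_iff_of_nonneg fun _ _ => by positivity] at hsum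
  simpa using hsum i hi

/-- for `n ≥ 2` and a tight frame `{f i}_{i=1}^k` of nonzero vectors for
`𝕜^n` (𝕜 = ℝ or ℂ) with `k ≥ n`, for every `1 ≤ r ≤ n - 1`: (i) removing any `r` of the
vectors never leaves a tight frame, and (ii) no `r` nonzero vectors can be added to
produce a tight frame; i.e. nontrivial `(r, 0)`- and `(0, r)`-surgeries are impossible. -/
theorem stmt13 {𝕜 : Type*} [RCLike 𝕜] {n k : ℕ} (hn : 2 ≤ n) (hkn : n ≤ k)
    (f : Fin k → EuclideanSpace 𝕜 (Fin n)) (hnz : ∀ i, f i ≠ 0)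
    (htight : ∃ μ : ℝ, 0 < μ ∧
      ∀ v : EuclideanSpace 𝕜 (Fin n), ∑ i, ‖⟪v, f i⟫_𝕜‖ ^ 2 = μ * ‖v‖ ^ 2)
    (r : ℕ) (hr1 : 1 ≤ r) (hrn : r ≤ n - 1) :
    (∀ I : Finset (Fin k), I.card = r →
      ¬ ∃ ν : ℝ, 0 < ν ∧
        ∀ v : EuclideanSpace 𝕜 (Fin n), ∑ i ∈ Iᶜ, ‖⟪v, f i⟫_𝕜‖ ^ 2 = ν * ‖v‖ ^ 2) ∧
    (¬ ∃ g : Fin r → EuclideanSpace 𝕜 (Fin n), (∀ j, g j ≠ 0) ∧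
      ∃ ν : ℝ, 0 < ν ∧
        ∀ v : EuclideanSpace 𝕜 (Fin n),
          (∑ i, ‖⟪v, f i⟫_𝕜‖ ^ 2) + ∑ j, ‖⟪v, g j⟫_𝕜‖ ^ 2 = ν * ‖v‖ ^ 2) := by
  obtain ⟨μ, -, hμ⟩ := htight
  have hrn' : r < Module.finrank 𝕜 (EuclideanSpace 𝕜 (Fin n)) := by
    rw [finrank_euclideanSpace_fin]
    omega
  refine ⟨?_, ?_⟩
  · rintro I hI ⟨ν, -, hν⟩
    obtain ⟨i, hi⟩ : I.Nonempty := Finset.card_pos.1 (by omega)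
    refine hnz i (eq_zero_of_sum_norm_inner_sq_eq I f (hI ▸ hrn') (μ - ν) (fun v => ?_) i hi)
    have hsplit := Finset.sum_add_sum_compl I fun i => ‖⟪v, f i⟫_𝕜‖ ^ 2
    linarith [hμ v, hν v]
  · rintro ⟨g, hg, ν, -, hν⟩
    refine hg ⟨0, hr1⟩ (eq_zero_of_sum_norm_inner_sq_eq (𝕜 := 𝕜) Finset.univ g
      (by rwa [Finset.card_univ, Fintype.card_fin]) (ν - μ) (fun v => ?_) _ (Finset.mem_univ _))
    linarith [hμ v, hν v]
end

section
/- Given an n-dimensional Hilbert space H_n and a sequence of positive scalars {a_i}_{i=1}^k, there exists a tight frame {f_i}_{i=1}^k for H_n with ‖f_i‖ = a_i for all i = 1,...,k if and only if max_i a_i² ≤ (1/n) Σ_{i=1}^k a_i². -/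
open scoped InnerProductSpace

theorem Finset.sum_eq_sum_of_eq_off_pair {ι : Type*} [Fintype ι] {F G : ι → ℝ} {i j : ι}
    (hij : i ≠ j) (hpair : F i + F j = G i + G j) (hoff : ∀ m, m ≠ i → m ≠ j → F m = G m) :
    ∑ m, F m = ∑ m, G m := by
  rw [← sub_eq_zero, ← Finset.sum_sub_distrib,
    Finset.sum_eq_add i j hij (fun m _ hm => by rw [hoff m hm.1 hm.2, sub_self]) (by simp) (by simp)]
  linarith

section Rotation

variable {𝕜 E : Type*} [RCLike 𝕜] [NormedAddCommGroup E] [InnerProductSpace 𝕜 E]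

theorem norm_rotation_sq_add (u w : E) {c s : ℝ} (hcs : c ^ 2 + s ^ 2 = 1) :
    ‖(c : 𝕜) • u + (s : 𝕜) • w‖ ^ 2 + ‖(-s : 𝕜) • u + (c : 𝕜) • w‖ ^ 2 =
      ‖u‖ ^ 2 + ‖w‖ ^ 2 := by
  rw [@norm_add_sq 𝕜, @norm_add_sq 𝕜]
  simp only [inner_smul_left, inner_smul_right, norm_smul, norm_neg, map_neg, RCLike.conj_ofReal,
    RCLike.norm_ofReal, mul_pow, sq_abs, neg_mul, RCLike.re_ofReal_mul]
  linear_combination (‖u‖ ^ 2 + ‖w‖ ^ 2) * hcs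

/-- Rotating a pair of vectors realizes every squared norm between those of the two vectors. -/
theorem exists_rotation_norm_sq_eq (u w : E) {t : ℝ}
    (ht : t ∈ Set.uIcc (‖u‖ ^ 2) (‖w‖ ^ 2)) :
    ∃ c s : ℝ, c ^ 2 + s ^ 2 = 1 ∧ ‖(c : 𝕜) • u + (s : 𝕜) • w‖ ^ 2 = t := by
  have hcont : Continuous fun θ : ℝ =>
      ‖((Real.cos θ : ℝ) : 𝕜) • u + ((Real.sin θ : ℝ) : 𝕜) • w‖ ^ 2 := by
    have hc : Continuous fun θ : ℝ => ((Real.cos θ : ℝ) : 𝕜) :=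
      RCLike.continuous_ofReal.comp Real.continuous_cos
    have hs : Continuous fun θ : ℝ => ((Real.sin θ : ℝ) : 𝕜) :=
      RCLike.continuous_ofReal.comp Real.continuous_sin
    fun_prop
  obtain ⟨θ, -, hθ⟩ := intermediate_value_uIcc (a := 0) (b := Real.pi / 2) hcont.continuousOn
    (by simpa using ht)
  exact ⟨Real.cos θ, Real.sin θ, Real.cos_sq_add_sin_sq θ, hθ⟩

end Rotation

section Parseval

variable (𝕜 : Type*) [RCLike 𝕜] {H : Type*} [NormedAddCommGroup H] [InnerProductSpace 𝕜 H]

/-- A finite Parseval frame, i.e. a `1`-tight frame. -/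
def IsParsevalFrame {ι : Type*} [Fintype ι] (f : ι → H) : Prop :=
  ∀ v : H, ∑ i, ‖⟪v, f i⟫_𝕜‖ ^ 2 = ‖v‖ ^ 2

variable {𝕜}

/-- A Parseval frame can be rotated in two coordinates so as to bring the corresponding squared
norms closer to each other. -/
theorem IsParsevalFrame.exists_update_pair {ι : Type*} [Fintype ι] {f : ι → H}
    (hf : IsParsevalFrame 𝕜 f) {d : ι → ℝ} {i j : ι} (hij : i ≠ j)
    (hi : d i ∈ Set.uIcc (‖f i‖ ^ 2) (‖f j‖ ^ 2)) (hsum : d i + d j = ‖f i‖ ^ 2 + ‖f j‖ ^ 2)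
    (hoff : ∀ m, m ≠ i → m ≠ j → ‖f m‖ ^ 2 = d m) :
    ∃ g : ι → H, IsParsevalFrame 𝕜 g ∧ ∀ m, ‖g m‖ ^ 2 = d m := by
  classical
  obtain ⟨c, s, hcs, ht⟩ := exists_rotation_norm_sq_eq (𝕜 := 𝕜) (f i) (f j) hi
  have hrot := norm_rotation_sq_add (𝕜 := 𝕜) (f i) (f j) hcs
  refine ⟨fun m => if m = i then (c : 𝕜) • f i + (s : 𝕜) • f j else
    if m = j then (-s : 𝕜) • f i + (c : 𝕜) • f j else f m, fun v => ?_, fun m => ?_⟩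
  · rw [← hf v]
    refine Finset.sum_eq_sum_of_eq_off_pair hij ?_ fun m hmi hmj => by simp [hmi, hmj]
    have := norm_rotation_sq_add (𝕜 := 𝕜) ⟪v, f i⟫_𝕜 ⟪v, f j⟫_𝕜 hcs
    simpa only [if_pos, if_neg hij.symm, inner_add_right, inner_smul_right, smul_eq_mul] using this
  · by_cases hmi : m = i
    · subst hmi
      simpa using ht
    by_cases hmj : m = j
    · subst hmj
      simp only [if_neg hmi, if_pos]
      linarith
    · simpa [hmi, hmj] using hoff m hmi hmj

theorem exists_isParsevalFrame_of_zero_or_one [FiniteDimensional 𝕜 H] {ι : Type*} [Fintype ι]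
    (d : ι → ℝ) (hd : ∀ i, d i = 0 ∨ d i = 1) (hsum : ∑ i, d i = Module.finrank 𝕜 H) :
    ∃ f : ι → H, IsParsevalFrame 𝕜 f ∧ ∀ i, ‖f i‖ ^ 2 = d i := by
  classical
  have hd' : ∀ i, d i = if d i = 1 then 1 else 0 := fun i => by
    rcases hd i with h | h <;> simp [h]
  have hcard : Fintype.card {i // d i = 1} = Module.finrank 𝕜 H := by
    rw [Fintype.card_subtype]
    rw [Finset.sum_congr rfl fun i _ => hd' i, Finset.sum_boole] at hsum
    exact_mod_cast hsum
  let b : OrthonormalBasis {i // d i = 1} 𝕜 H :=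
    (stdOrthonormalBasis 𝕜 H).reindex (Fintype.equivFinOfCardEq hcard).symm
  refine ⟨fun i => if h : d i = 1 then b ⟨i, h⟩ else 0, fun v => ?_, fun i => ?_⟩
  · rw [← b.sum_sq_norm_inner_left v]
    refine (Finset.sum_subset (Finset.subset_univ (Finset.univ.filter (d · = 1)))
      fun i _ hi => ?_).symm.trans ?_
    · have h : d i ≠ 1 := by simpa using hi
      simp [h]
    · rw [Finset.sum_subtype (p := fun i => d i = 1) _ (by simp)]
      exact Finset.sum_congr rfl fun i _ => by simp [i.2]
  · by_cases h : d i = 1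
    · simp [h]
    · simp [(hd i).resolve_right h]

/-- A `[0, 1]`-valued function with integral sum has no fractional value as soon as it has at most
one. -/
theorem eq_zero_or_one_of_sum_eq_natCast {ι : Type*} [Fintype ι] {d : ι → ℝ} {n : ℕ}
    (h0 : ∀ i, 0 ≤ d i) (h1 : ∀ i, d i ≤ 1) (hsum : ∑ i, d i = n)
    (hsub : ∀ i j, d i ≠ 0 → d i ≠ 1 → d j ≠ 0 → d j ≠ 1 → i = j) (i : ι) :
    d i = 0 ∨ d i = 1 := by
  classical
  by_contra! hi
  have hd' : ∀ j ∈ Finset.univ.erase i, d j = if d j = 1 then 1 else 0 := fun j hj => by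
    by_cases hj1 : d j = 1
    · simp [hj1]
    · by_cases hj0 : d j = 0
      · simp [hj0]
      · exact absurd (hsub j i hj0 hj1 hi.1 hi.2) (Finset.ne_of_mem_erase hj)
  rw [← Finset.add_sum_erase _ _ (Finset.mem_univ i), Finset.sum_congr rfl hd',
    Finset.sum_boole] at hsum
  have hpos := (h0 i).lt_of_ne' hi.1
  have hlt := (h1 i).lt_of_ne hi.2
  generalize Finset.card _ = p at hsum
  have hpn : p < n := by
    have : (p : ℝ) < n := by linarith
    exact_mod_cast this
  have hnp : n < p + 1 := by
    have : (n : ℝ) < p + 1 := by linarith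
    exact_mod_cast this
  omega

/-- Two fractions in `(0, 1)` can be spread apart, keeping their sum, until one of them becomes
`0` or `1`. -/
theorem exists_spread_pair {x y : ℝ} (hx0 : 0 ≤ x) (hx1 : x ≤ 1) (hy0 : 0 ≤ y) (hy1 : y ≤ 1) :
    ∃ p q : ℝ, (p = 0 ∨ p = 1) ∧ 0 ≤ q ∧ q ≤ 1 ∧ x + y = p + q ∧ x ∈ Set.uIcc p q := by
  rcases le_total (x + y) 1 with h | h
  · exact ⟨0, x + y, .inl rfl, by linarith, h, by ring, Set.mem_uIcc_of_le hx0 (by linarith)⟩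
  · exact ⟨1, x + y - 1, .inr rfl, by linarith, by linarith, by ring,
      Set.mem_uIcc_of_ge (by linarith) hx1⟩

theorem exists_isParsevalFrame_norm_sq_eq [FiniteDimensional 𝕜 H] {ι : Type*} [Fintype ι]
    (d : ι → ℝ) (h0 : ∀ i, 0 ≤ d i) (h1 : ∀ i, d i ≤ 1)
    (hsum : ∑ i, d i = Module.finrank 𝕜 H) :
    ∃ f : ι → H, IsParsevalFrame 𝕜 f ∧ ∀ i, ‖f i‖ ^ 2 = d i := by
  classical
  induction hN : (Finset.univ.filter fun i => d i ≠ 0 ∧ d i ≠ 1).card using Nat.strong_induction_on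
    generalizing d with
  | _ N ih =>
  by_cases hsub : ∀ i j, d i ≠ 0 → d i ≠ 1 → d j ≠ 0 → d j ≠ 1 → i = j
  · exact exists_isParsevalFrame_of_zero_or_one d
      (eq_zero_or_one_of_sum_eq_natCast h0 h1 hsum hsub) hsum
  push Not at hsub
  obtain ⟨i, j, hi0, hi1, hj0, hj1, hij⟩ := hsub
  obtain ⟨p, q, hp, hq0, hq1, hpq, hmem⟩ := exists_spread_pair (h0 i) (h1 i) (h0 j) (h1 j)
  let e : ι → ℝ := fun m => if m = i then p else if m = j then q else d m
  have hei : e i = p := if_pos rfl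
  have hej : e j = q := by simp [e, hij.symm]
  have hem : ∀ m, m ≠ i → m ≠ j → e m = d m := fun m hmi hmj => by simp [e, hmi, hmj]
  have he : ∀ m, 0 ≤ e m ∧ e m ≤ 1 := fun m => by
    by_cases hmi : m = i
    · rw [hmi, hei]
      rcases hp with rfl | rfl <;> norm_num
    by_cases hmj : m = j
    · rw [hmj, hej]
      exact ⟨hq0, hq1⟩
    · rw [hem m hmi hmj]
      exact ⟨h0 m, h1 m⟩
  have hesum : ∑ m, e m = Module.finrank 𝕜 H := by
    rw [← hsum]
    exact Finset.sum_eq_sum_of_eq_off_pair hij (by rw [hei, hej, hpq]) hem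
  have hlt : (Finset.univ.filter fun m => e m ≠ 0 ∧ e m ≠ 1).card < N := by
    rw [← hN]
    refine Finset.card_lt_card (Finset.ssubset_iff_of_subset (fun m hm => ?_) |>.2
      ⟨i, by simp [hi0, hi1], by rcases hp with rfl | rfl <;> simp [hei]⟩)
    simp only [Finset.mem_filter, Finset.mem_univ, true_and] at hm ⊢
    by_cases hmi : m = i
    · exact hmi ▸ ⟨hi0, hi1⟩
    by_cases hmj : m = j
    · exact hmj ▸ ⟨hj0, hj1⟩
    · rwa [← hem m hmi hmj]
  obtain ⟨f, hf, hfe⟩ := ih _ hlt e (fun m => (he m).1) (fun m => (he m).2) hesum rfl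
  refine hf.exists_update_pair hij ?_ ?_ fun m hmi hmj => by rw [hfe, hem m hmi hmj]
  · rwa [hfe, hfe, hei, hej]
  · rw [hfe, hfe, hei, hej, hpq]

end Parseval

section Tight

variable {𝕜 : Type*} [RCLike 𝕜] {H : Type*} [NormedAddCommGroup H] [InnerProductSpace 𝕜 H]
  {ι : Type*} [Fintype ι] {f : ι → H} {μ : ℝ}

theorem sum_norm_sq_eq_of_tight [FiniteDimensional 𝕜 H]
    (hf : ∀ v : H, ∑ i, ‖⟪v, f i⟫_𝕜‖ ^ 2 = μ * ‖v‖ ^ 2) :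
    ∑ i, ‖f i‖ ^ 2 = Module.finrank 𝕜 H * μ := by
  let b := stdOrthonormalBasis 𝕜 H
  calc ∑ i, ‖f i‖ ^ 2 = ∑ i, ∑ j, ‖⟪b j, f i⟫_𝕜‖ ^ 2 :=
        Finset.sum_congr rfl fun i _ => (b.sum_sq_norm_inner_right (f i)).symm
    _ = ∑ j, ∑ i, ‖⟪b j, f i⟫_𝕜‖ ^ 2 := Finset.sum_comm
    _ = Module.finrank 𝕜 H * μ := by simp [hf]

theorem norm_sq_le_of_tight (hμ : 0 ≤ μ)
    (hf : ∀ v : H, ∑ i, ‖⟪v, f i⟫_𝕜‖ ^ 2 = μ * ‖v‖ ^ 2) (i : ι) : ‖f i‖ ^ 2 ≤ μ := by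
  rcases eq_or_ne (f i) 0 with h | h
  · simpa [h] using hμ
  have hle := Finset.single_le_sum (f := fun j => ‖⟪f i, f j⟫_𝕜‖ ^ 2)
    (fun j _ => sq_nonneg _) (Finset.mem_univ i)
  rw [hf, inner_self_eq_norm_sq_to_K, norm_pow, RCLike.norm_ofReal, abs_norm, sq (‖f i‖ ^ 2)] at hle
  exact le_of_mul_le_mul_right hle (by positivity)

end Tight

/-- the fundamental inequality: given an `n`-dimensional Hilbert space `H`
(`n ≥ 1`) and positive scalars `a 1, ..., a k` (`k ≥ 1`), there is a tight frame
`{f i}_{i=1}^k` for `H` with `‖f i‖ = a i` for all `i` iff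
`max_i (a i)² ≤ (1/n) * ∑ i, (a i)²`. -/
theorem stmt16 {𝕜 : Type*} [RCLike 𝕜] {H : Type*} [NormedAddCommGroup H]
    [InnerProductSpace 𝕜 H] [FiniteDimensional 𝕜 H] {n k : ℕ} (hn : 0 < n) (hk : 0 < k)
    (hfin : Module.finrank 𝕜 H = n) (a : Fin k → ℝ) (ha : ∀ i, 0 < a i) :
    (∃ f : Fin k → H,
        (∃ μ : ℝ, 0 < μ ∧ ∀ v : H, ∑ i, ‖⟪v, f i⟫_𝕜‖ ^ 2 = μ * ‖v‖ ^ 2) ∧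
        ∀ i, ‖f i‖ = a i) ↔
      ∀ i, a i ^ 2 ≤ (1 / (n : ℝ)) * ∑ j, a j ^ 2 := by
  have hn' : (0 : ℝ) < n := by exact_mod_cast hn
  constructor
  · rintro ⟨f, ⟨μ, hμ, hf⟩, hfa⟩ i
    have hsum := sum_norm_sq_eq_of_tight hf
    simp only [hfa, hfin] at hsum
    rw [hsum, ← mul_assoc, one_div_mul_cancel hn'.ne', one_mul, ← hfa i]
    exact norm_sq_le_of_tight hμ.le hf i
  · intro h
    set μ : ℝ := 1 / (n : ℝ) * ∑ j, a j ^ 2 with hμdef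
    have hμ : 0 < μ := (pow_pos (ha ⟨0, hk⟩) 2).trans_le (h ⟨0, hk⟩)
    obtain ⟨g, hg, hga⟩ := exists_isParsevalFrame_norm_sq_eq (𝕜 := 𝕜) (H := H)
      (fun i => a i ^ 2 / μ) (fun i => by positivity) (fun i => (div_le_one hμ).2 (h i)) (by
        rw [← Finset.sum_div, hfin, div_eq_iff hμ.ne', hμdef, ← mul_assoc,
          mul_one_div_cancel hn'.ne', one_mul])
    refine ⟨fun i => ((√μ : ℝ) : 𝕜) • g i, ⟨μ, hμ, fun v => ?_⟩, fun i => ?_⟩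
    · simp only [inner_smul_right, norm_mul, RCLike.norm_ofReal, mul_pow, sq_abs,
        Real.sq_sqrt hμ.le, ← Finset.mul_sum, hg v]
    · rw [← sq_eq_sq₀ (norm_nonneg _) (ha i).le, norm_smul, RCLike.norm_ofReal, mul_pow, sq_abs,
        Real.sq_sqrt hμ.le, hga, mul_div_cancel₀ _ hμ.ne']
end

section
/- Let n ≥ 2, k ≥ 2, suppose {a_i}_{i=1}^k is a tight frame set for H_n, let b be a nonnegative scalar, and set m := max_{2 ≤ i ≤ k} a_i². Then {b, a_2, ..., a_k} is a tight frame set for H_n if and only if n·m − Σ_{i=2}^k a_i² ≤ b² ≤ (1/(n−1)) Σ_{i=2}^k a_i². -/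
open scoped InnerProductSpace

/-- A finite family of nonnegative numbers `a` is a tight frame set for `H` if there is a
tight frame `f` for `H` with `‖f i‖ = a i` for all `i`. -/
def IsTightFrameSet (𝕜 : Type*) [RCLike 𝕜] (H : Type*) [NormedAddCommGroup H]
    [InnerProductSpace 𝕜 H] {ι : Type*} [Fintype ι] (a : ι → ℝ) : Prop :=
  ∃ f : ι → H,
    (∃ μ : ℝ, 0 < μ ∧ ∀ v : H, ∑ i, ‖⟪v, f i⟫_𝕜‖ ^ 2 = μ * ‖v‖ ^ 2) ∧
    ∀ i, ‖f i‖ = a i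

section TightFrames

variable {𝕜 : Type*} [RCLike 𝕜] {H : Type*} [NormedAddCommGroup H] [InnerProductSpace 𝕜 H]
  {ι : Type*} [Fintype ι]

/-- `d` is the family of squared norms of some `μ`-tight frame for `H`. -/
def IsTightFrameSqNorms (𝕜 : Type*) [RCLike 𝕜] {H : Type*} [NormedAddCommGroup H]
    [InnerProductSpace 𝕜 H] {ι : Type*} [Fintype ι] (μ : ℝ) (d : ι → ℝ) : Prop :=
  ∃ f : ι → H, (∀ v : H, ∑ i, ‖⟪v, f i⟫_𝕜‖ ^ 2 = μ * ‖v‖ ^ 2) ∧ ∀ i, ‖f i‖ ^ 2 = d i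

theorem norm_sq_rotation (x y : H) {c s : ℝ} (h : c ^ 2 + s ^ 2 = 1) :
    ‖(c : 𝕜) • x + (s : 𝕜) • y‖ ^ 2 + ‖(c : 𝕜) • y - (s : 𝕜) • x‖ ^ 2 = ‖x‖ ^ 2 + ‖y‖ ^ 2 := by
  rw [@norm_add_sq 𝕜, @norm_sub_sq 𝕜]
  simp only [inner_smul_left, inner_smul_right, norm_smul, RCLike.conj_ofReal,
    RCLike.norm_ofReal, mul_pow, sq_abs, RCLike.re_ofReal_mul]
  rw [inner_re_symm (𝕜 := 𝕜) y x]
  linear_combination (‖x‖ ^ 2 + ‖y‖ ^ 2) * h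

theorem sum_eq_pair_add_sum_erase [DecidableEq ι] {i j : ι} (hij : i ≠ j) (g : ι → ℝ) :
    ∑ l, g l = g i + g j + ∑ l ∈ (Finset.univ.erase i).erase j, g l := by
  rw [← Finset.add_sum_erase _ _ (Finset.mem_univ i),
    ← Finset.add_sum_erase (Finset.univ.erase i) _ (show j ∈ _ by simp [hij.symm]), add_assoc]

/-- Rotating two members of a tight frame transfers squared norm from the longer one to the
shorter one. -/
theorem IsTightFrameSqNorms.transfer [DecidableEq ι] {μ : ℝ} {d : ι → ℝ}
    (hd : IsTightFrameSqNorms 𝕜 (H := H) μ d) {i j : ι} (hij : i ≠ j) {δ : ℝ} (hδ : 0 ≤ δ)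
    (hle : d j + δ ≤ d i) :
    IsTightFrameSqNorms 𝕜 (H := H) μ
      (Function.update (Function.update d i (d i - δ)) j (d j + δ)) := by
  obtain ⟨f, hf, hn⟩ := hd
  obtain ⟨θ, -, hθ⟩ : ∃ θ ∈ Set.Icc 0 (Real.pi / 2),
      ‖(Real.cos θ : 𝕜) • f i + (Real.sin θ : 𝕜) • f j‖ ^ 2 = d i - δ := by
    refine intermediate_value_Icc' (by positivity) (f := fun θ : ℝ =>
      ‖(Real.cos θ : 𝕜) • f i + (Real.sin θ : 𝕜) • f j‖ ^ 2) ?_ ?_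
    · apply Continuous.continuousOn
      have h1 : Continuous fun θ : ℝ => (Real.cos θ : 𝕜) :=
        RCLike.continuous_ofReal.comp Real.continuous_cos
      have h2 : Continuous fun θ : ℝ => (Real.sin θ : 𝕜) :=
        RCLike.continuous_ofReal.comp Real.continuous_sin
      fun_prop
    · simp only [Real.cos_zero, Real.sin_zero, Real.cos_pi_div_two, Real.sin_pi_div_two,
        RCLike.ofReal_one, RCLike.ofReal_zero, one_smul, zero_smul, add_zero, zero_add, hn]
      constructor <;> linarith
  set x := (Real.cos θ : 𝕜) • f i + (Real.sin θ : 𝕜) • f j with hx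
  set y := (Real.cos θ : 𝕜) • f j - (Real.sin θ : 𝕜) • f i with hy
  have hcs := Real.cos_sq_add_sin_sq θ
  refine ⟨Function.update (Function.update f i x) j y, fun v => ?_, fun l => ?_⟩
  · rw [← hf v, sum_eq_pair_add_sum_erase hij, sum_eq_pair_add_sum_erase hij]
    congr 1
    · simp only [Function.update_self, Function.update_of_ne hij]
      rw [← norm_sq_rotation (𝕜 := 𝕜) ⟪v, f i⟫_𝕜 ⟪v, f j⟫_𝕜 hcs, hx, hy]
      simp only [inner_add_right, inner_sub_right, inner_smul_right, smul_eq_mul]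
    · refine Finset.sum_congr rfl fun l hl => ?_
      simp only [Finset.mem_erase] at hl
      rw [Function.update_of_ne hl.1, Function.update_of_ne hl.2.1]
  · rcases eq_or_ne l j with rfl | hlj
    · have := norm_sq_rotation (𝕜 := 𝕜) (f i) (f l) hcs
      rw [← hx, ← hy, hθ, hn, hn] at this
      simp only [Function.update_self]
      linarith
    rcases eq_or_ne l i with rfl | hli
    · simpa [Function.update_of_ne hlj] using hθ
    · simpa [Function.update_of_ne hlj, Function.update_of_ne hli] using hn l

/-- If `d` dominates `c` on `s`, is dominated by `c` off `s`, and the values of `c` on `s` exceed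
those off `s`, then squared norms `d` can be moved to `c`. -/
theorem IsTightFrameSqNorms.of_top [DecidableEq ι] {μ : ℝ} {c : ι → ℝ} {s : Finset ι}
    (hs : ∀ i ∈ s, ∀ j ∉ s, c j ≤ c i) {d : ι → ℝ}
    (hd : IsTightFrameSqNorms 𝕜 (H := H) μ d) (h1 : ∀ i ∈ s, c i ≤ d i)
    (h2 : ∀ j ∉ s, d j ≤ c j) (hsum : ∑ i, d i = ∑ i, c i) :
    IsTightFrameSqNorms 𝕜 (H := H) μ c := by
  induction hN : (Finset.univ.filter fun i => d i ≠ c i).card using Nat.strong_induction_on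
    generalizing d with
  | _ N ih =>
  by_cases hdc : d = c
  · exact hdc ▸ hd
  have hex : (∃ i ∈ s, c i < d i) ∧ ∃ j, j ∉ s ∧ d j < c j := by
    obtain ⟨l, hl⟩ := Function.ne_iff.mp hdc
    constructor
    · by_contra! hcon
      have hle : ∀ i ∈ Finset.univ, d i ≤ c i := fun i _ =>
        if hi : i ∈ s then hcon i hi else h2 i hi
      exact hl ((Finset.sum_eq_sum_iff_of_le hle).mp hsum l (Finset.mem_univ l))
    · by_contra! hcon
      have hle : ∀ i ∈ Finset.univ, c i ≤ d i := fun i _ =>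
        if hi : i ∈ s then h1 i hi else hcon i hi
      exact hl ((Finset.sum_eq_sum_iff_of_le hle).mp hsum.symm l (Finset.mem_univ l)).symm
  obtain ⟨⟨i, his, hi⟩, j, hjs, hj⟩ := hex
  have hij : i ≠ j := fun h => hjs (h ▸ his)
  have hcij := hs i his j hjs
  obtain ⟨δ, hδ0, hδi, hδj, hδ⟩ : ∃ δ : ℝ, 0 ≤ δ ∧ δ ≤ d i - c i ∧ δ ≤ c j - d j ∧
      (δ = d i - c i ∨ δ = c j - d j) :=
    ⟨min (d i - c i) (c j - d j), le_min (by linarith) (by linarith), min_le_left _ _,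
      min_le_right _ _, min_choice _ _⟩
  set d' := Function.update (Function.update d i (d i - δ)) j (d j + δ) with hd'
  have hd'i : d' i = d i - δ := by simp [hd', Function.update_of_ne hij]
  have hd'j : d' j = d j + δ := by simp [hd']
  have hd'l : ∀ l, l ≠ i → l ≠ j → d' l = d l := fun l hli hlj => by
    simp [hd', Function.update_of_ne hli, Function.update_of_ne hlj]
  have htrans : IsTightFrameSqNorms 𝕜 (H := H) μ d' := hd.transfer hij hδ0 (by linarith)
  clear_value d'
  refine ih _ ?_ htrans (fun l hl => ?_) (fun l hl => ?_) ?_ rfl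
  · rw [← hN]
    apply Finset.card_lt_card
    rw [Finset.ssubset_iff_of_subset]
    · rcases hδ with hδ | hδ
      · exact ⟨i, by simpa using hi.ne', by simp [hd'i, hδ]⟩
      · exact ⟨j, by simpa using hj.ne, by simp [hd'j, hδ]⟩
    · intro l hl
      simp only [Finset.mem_filter, Finset.mem_univ, true_and] at hl ⊢
      rcases eq_or_ne l i with rfl | hli
      · exact hi.ne'
      rcases eq_or_ne l j with rfl | hlj
      · exact hj.ne
      rwa [hd'l l hli hlj] at hl
  · have hlj : l ≠ j := fun h => hjs (h ▸ hl)
    rcases eq_or_ne l i with rfl | hli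
    · rw [hd'i]; linarith
    · rw [hd'l l hli hlj]; exact h1 l hl
  · have hli : l ≠ i := fun h => hl (h ▸ his)
    rcases eq_or_ne l j with rfl | hlj
    · rw [hd'j]; linarith
    · rw [hd'l l hli hlj]; exact h2 l hl
  · rw [← hsum, sum_eq_pair_add_sum_erase hij, sum_eq_pair_add_sum_erase hij d, hd'i, hd'j]
    congr 1
    · ring
    · refine Finset.sum_congr rfl fun l hl => ?_
      simp only [Finset.mem_erase] at hl
      exact hd'l l hl.2.1 hl.1

theorem exists_top_finset (c : ι → ℝ) {n : ℕ} (hn : n ≤ Fintype.card ι) :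
    ∃ s : Finset ι, s.card = n ∧ ∀ i ∈ s, ∀ j ∉ s, c j ≤ c i := by
  classical
  induction n with
  | zero => exact ⟨∅, by simp⟩
  | succ n ih =>
    obtain ⟨s, hcard, hs⟩ := ih (by omega)
    have hne : sᶜ.Nonempty := by
      rw [← Finset.card_pos, Finset.card_compl]
      omega
    obtain ⟨m, hm, hmax⟩ := Finset.exists_max_image sᶜ c hne
    rw [Finset.mem_compl] at hm
    refine ⟨insert m s, by rw [Finset.card_insert_of_notMem hm, hcard], fun i hi j hj => ?_⟩
    simp only [Finset.mem_insert, not_or] at hi hj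
    rcases hi with rfl | hi
    · exact hmax j (by simpa using hj.2)
    · exact hs i hi j hj.2

/-- A scaled orthonormal basis, padded with zeros, is a tight frame. -/
theorem isTightFrameSqNorms_indicator [DecidableEq ι] [FiniteDimensional 𝕜 H] {s : Finset ι}
    (hs : s.card = Module.finrank 𝕜 H) {μ : ℝ} (hμ : 0 ≤ μ) :
    IsTightFrameSqNorms 𝕜 (H := H) μ fun i => if i ∈ s then μ else 0 := by
  let B : OrthonormalBasis s 𝕜 H := (stdOrthonormalBasis 𝕜 H).reindex
    (Fintype.equivOfCardEq (by simp [hs]))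
  refine ⟨fun i => if h : i ∈ s then ((√μ : ℝ) : 𝕜) • B ⟨i, h⟩ else 0, fun v => ?_, fun i => ?_⟩
  · rw [← B.sum_sq_norm_inner_left v, Finset.mul_sum,
      ← Finset.sum_subset (Finset.subset_univ s), ← Finset.sum_coe_sort s]
    · refine Finset.sum_congr rfl fun i _ => ?_
      simp [inner_smul_right, mul_pow, Real.sq_sqrt hμ, abs_of_nonneg]
    · intro i _ hi
      simp [hi]
  · by_cases hi : i ∈ s
    · simp [hi, norm_smul, Real.sq_sqrt hμ, abs_of_nonneg]
    · simp [hi]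

/-- The fundamental inequality characterizing norms of tight frames. -/
theorem isTightFrameSet_iff [FiniteDimensional 𝕜 H] (hpos : 0 < Module.finrank 𝕜 H)
    {c : ι → ℝ} (hc : ∀ i, 0 ≤ c i) :
    IsTightFrameSet 𝕜 H c ↔
      0 < ∑ i, c i ^ 2 ∧ ∀ i, (Module.finrank 𝕜 H : ℝ) * c i ^ 2 ≤ ∑ i, c i ^ 2 := by
  classical
  have hpos' : (0 : ℝ) < Module.finrank 𝕜 H := by exact_mod_cast hpos
  constructor
  · rintro ⟨f, ⟨μ, hμ, hf⟩, hn⟩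
    let B := stdOrthonormalBasis 𝕜 H
    have hsum : ∑ i, c i ^ 2 = Module.finrank 𝕜 H * μ := by
      calc ∑ i, c i ^ 2 = ∑ i, ∑ l, ‖⟪B l, f i⟫_𝕜‖ ^ 2 :=
            Finset.sum_congr rfl fun i _ => by rw [B.sum_sq_norm_inner_right, hn]
        _ = ∑ l, ∑ i, ‖⟪B l, f i⟫_𝕜‖ ^ 2 := Finset.sum_comm
        _ = Module.finrank 𝕜 H * μ := by simp [hf]
    refine ⟨hsum ▸ by positivity, fun i => ?_⟩
    rw [hsum]
    refine mul_le_mul_of_nonneg_left ?_ hpos'.le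
    have h := Finset.single_le_sum (f := fun l => ‖⟪f i, f l⟫_𝕜‖ ^ 2)
      (fun l _ => by positivity) (Finset.mem_univ i)
    rw [hf, inner_self_eq_norm_sq_to_K, hn] at h
    simp only [norm_pow, RCLike.norm_ofReal, sq_abs] at h
    rcases (sq_nonneg (c i)).eq_or_lt with h0 | h0
    · rw [← h0]; exact hμ.le
    · rw [sq (c i ^ 2)] at h
      exact le_of_mul_le_mul_right h h0
  · rintro ⟨hT, hle⟩
    set T := ∑ i, c i ^ 2 with hTdef
    have hcard : Module.finrank 𝕜 H ≤ Fintype.card ι := by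
      have h : ∑ i : ι, (Module.finrank 𝕜 H : ℝ) * c i ^ 2 ≤ ∑ _i : ι, T :=
        Finset.sum_le_sum fun i _ => hle i
      rw [← Finset.mul_sum, ← hTdef, Finset.sum_const, nsmul_eq_mul, Finset.card_univ] at h
      exact_mod_cast le_of_mul_le_mul_right h hT
    obtain ⟨s, hs, htop⟩ := exists_top_finset (fun i => c i ^ 2) hcard
    have hμ : 0 < T / Module.finrank 𝕜 H := by positivity
    obtain ⟨f, hf, hn⟩ := (isTightFrameSqNorms_indicator (H := H) hs hμ.le).of_top htop
      (fun i hi => by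
        simp only [hi, if_true]
        rw [le_div_iff₀ hpos', mul_comm]
        exact hle i)
      (fun j hj => by simp only [hj, if_false]; positivity)
      (by
        rw [Finset.sum_ite_mem, Finset.univ_inter, Finset.sum_const, hs, nsmul_eq_mul]
        field_simp
        exact hTdef)
    exact ⟨f, ⟨_, hμ, hf⟩, fun i =>
      (pow_left_inj₀ (norm_nonneg _) (hc i) two_ne_zero).mp (hn i)⟩

end TightFrames

/-- let `n, k ≥ 2`, let `{a i}_{i=1}^k` be a tight frame set for an
`n`-dimensional Hilbert space `H`, let `b ≥ 0`, and set `m := max_{2 ≤ i ≤ k} (a i)²`.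
Then `{b, a 2, ..., a k}` (obtained by replacing the first entry by `b`) is a tight frame
set for `H` iff `n * m - ∑_{i=2}^k (a i)² ≤ b² ≤ (1/(n-1)) ∑_{i=2}^k (a i)²`.
(Indices of `a : Fin k → ℝ` are 0-based.) -/
theorem stmt18 {𝕜 : Type*} [RCLike 𝕜] {H : Type*} [NormedAddCommGroup H]
    [InnerProductSpace 𝕜 H] [FiniteDimensional 𝕜 H] {n k : ℕ}
    (hfin : Module.finrank 𝕜 H = n) (hn : 2 ≤ n) (hk : 2 ≤ k)
    (a : Fin k → ℝ) (hTFS : IsTightFrameSet 𝕜 H a) (b : ℝ) (hb : 0 ≤ b)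
    (hk0 : 0 < k) :
    IsTightFrameSet 𝕜 H (Function.update a ⟨0, hk0⟩ b) ↔
      ((n : ℝ) * sSup {x : ℝ | ∃ i : Fin k, 1 ≤ (i : ℕ) ∧ x = a i ^ 2} -
          ∑ i ∈ Finset.univ.filter (fun i : Fin k => 1 ≤ (i : ℕ)), a i ^ 2 ≤ b ^ 2 ∧
        b ^ 2 ≤ (1 / ((n : ℝ) - 1)) *
          ∑ i ∈ Finset.univ.filter (fun i : Fin k => 1 ≤ (i : ℕ)), a i ^ 2) := by
  have hn2 : (2 : ℝ) ≤ n := by exact_mod_cast hn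
  have hpos : 0 < Module.finrank 𝕜 H := by omega
  have ha : ∀ i, 0 ≤ a i := by
    obtain ⟨f, -, hf⟩ := hTFS
    exact fun i => hf i ▸ norm_nonneg _
  set z : Fin k := ⟨0, hk0⟩ with hz
  have hne : ∀ i : Fin k, 1 ≤ (i : ℕ) ↔ i ≠ z := fun i => by
    rw [Ne, Fin.ext_iff]
    exact Nat.one_le_iff_ne_zero
  have hfilter : Finset.univ.filter (fun i : Fin k => 1 ≤ (i : ℕ)) = Finset.univ.erase z := by
    ext i
    simp [hne]
  simp only [hfilter]
  set S := ∑ i ∈ Finset.univ.erase z, a i ^ 2 with hS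
  have hsum : ∑ i, a i ^ 2 = a z ^ 2 + S := (Finset.add_sum_erase _ _ (Finset.mem_univ z)).symm
  have hsum' : ∑ i, Function.update a z b i ^ 2 = b ^ 2 + S := by
    rw [← Finset.add_sum_erase _ _ (Finset.mem_univ z), Function.update_self]
    congr 1
    refine Finset.sum_congr rfl fun i hi => ?_
    rw [Function.update_of_ne (Finset.ne_of_mem_erase hi)]
  have hb' : ∀ i, 0 ≤ Function.update a z b i := fun i => by
    rcases eq_or_ne i z with rfl | hi
    · simpa using hb
    · simpa [Function.update_of_ne hi] using ha i
  rw [isTightFrameSet_iff hpos ha, hsum, hfin] at hTFS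
  obtain ⟨hT, haz⟩ := hTFS
  have hSpos : 0 < S := by
    nlinarith [haz z, sq_nonneg (a z)]
  have hbdd : BddAbove {x : ℝ | ∃ i : Fin k, 1 ≤ (i : ℕ) ∧ x = a i ^ 2} :=
    ((Set.finite_range fun i => a i ^ 2).subset
      (by rintro _ ⟨i, -, rfl⟩; exact ⟨i, rfl⟩)).bddAbove
  have hnonempty : {x : ℝ | ∃ i : Fin k, 1 ≤ (i : ℕ) ∧ x = a i ^ 2}.Nonempty :=
    ⟨_, ⟨1, hk⟩, le_rfl, rfl⟩
  have hupper : b ^ 2 ≤ 1 / ((n : ℝ) - 1) * S ↔ n * b ^ 2 ≤ b ^ 2 + S := by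
    rw [one_div_mul_eq_div, le_div_iff₀ (by linarith)]
    constructor <;> intro h <;> linarith
  rw [isTightFrameSet_iff hpos hb', hsum', hfin, hupper]
  constructor
  · rintro ⟨-, h⟩
    refine ⟨?_, by simpa using h z⟩
    rw [sub_le_iff_le_add, mul_comm, ← le_div_iff₀ (by linarith)]
    refine csSup_le hnonempty ?_
    rintro _ ⟨i, hi, rfl⟩
    rw [le_div_iff₀ (by linarith), mul_comm]
    simpa [Function.update_of_ne ((hne i).mp hi)] using h i
  · rintro ⟨h1, h2⟩
    refine ⟨by positivity, fun i => ?_⟩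
    rcases eq_or_ne i z with rfl | hi
    · simpa using h2
    · rw [Function.update_of_ne hi]
      have hle : a i ^ 2 ≤ sSup {x : ℝ | ∃ i : Fin k, 1 ≤ (i : ℕ) ∧ x = a i ^ 2} :=
        le_csSup hbdd ⟨i, (hne i).mpr hi, rfl⟩
      nlinarith
end
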